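/- Let n ∈ ℕ, let p0, p1, p2 ∈ [0,1], and for each i = 1,…,n let W_i be a channel from {0,1} to a finite set Y_i. For j ∈ {0,1,2} set P^{(j)}_i = W_i∘Ber(p_j) and P^{(j)}_{Y^n} = ⊗_{i=1}^n P^{(j)}_i. Suppose λ > 0 is such that H²(P^{(0)}_i, P^{(1)}_i) ≥ λ·H²(P^{(1)}_i, P^{(2)}_i) for every i = 1,…,n. Then either d_TV(P^{(1)}_{Y^n}, P^{(2)}_{Y^n}) ≤ 1/2, or d_TV(P^{(0)}_{Y^n}, P^{(1)}_{Y^n}) ≥ 1 − e^{−(1−√3/2)·λ}. -/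

import Mathlib

/-- The Bernoulli distribution on `{0,1}` (as `Bool`) with `bern p true = p`. -/
noncomputable def bern (p : ℝ) : Bool → ℝ := fun b => if b then p else 1 - p

/-- The output distribution `W ∘ μ` of the channel `W` on input distribution `μ`. -/
noncomputable def pushChannel {X Y : Type} [Fintype X] (W : X → Y → ℝ) (μ : X → ℝ) : Y → ℝ :=
  fun y => ∑ x, μ x * W x y

/-- `W` is a channel from `X` to the finite set `Y`: each row `W x` is a pmf on `Y`. -/
def IsChannel {X Y : Type} [Fintype Y] (W : X → Y → ℝ) : Prop :=
  ∀ x, (∀ y, 0 ≤ W x y) ∧ ∑ y, W x y = 1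

/-- Total variation distance between two pmfs on a finite set. -/
noncomputable def tvDist {S : Type} [Fintype S] (P Q : S → ℝ) : ℝ :=
  (∑ s, |P s - Q s|) / 2

/-- Squared Hellinger distance between two pmfs on a finite set. -/
noncomputable def hellingerSq {S : Type} [Fintype S] (P Q : S → ℝ) : ℝ :=
  ∑ s, (Real.sqrt (P s) - Real.sqrt (Q s)) ^ 2

/-- Product distribution `⊗ᵢ Pᵢ`. -/
noncomputable def prodDist {n : ℕ} {Y : Fin n → Type} (P : (i : Fin n) → Y i → ℝ) :
    ((i : Fin n) → Y i) → ℝ :=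
  fun y => ∏ i, P i (y i)

/-- The Bhattacharyya coefficient of two functions on a finite set. -/
noncomputable def bhattacharyya {S : Type} [Fintype S] (P Q : S → ℝ) : ℝ :=
  ∑ s, √(P s) * √(Q s)

lemma bhattacharyya_nonneg {S : Type} [Fintype S] (P Q : S → ℝ) : 0 ≤ bhattacharyya P Q :=
  Finset.sum_nonneg fun _ _ => by positivity

lemma hellingerSq_nonneg {S : Type} [Fintype S] (P Q : S → ℝ) : 0 ≤ hellingerSq P Q :=
  Finset.sum_nonneg fun _ _ => sq_nonneg _

lemma sqrt_sub_mul_sqrt_add {a b : ℝ} (ha : 0 ≤ a) (hb : 0 ≤ b) :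
    (√a - √b) * (√a + √b) = a - b := by
  linear_combination Real.sq_sqrt ha - Real.sq_sqrt hb

section Pmf

variable {S : Type} [Fintype S] {P Q : S → ℝ}

lemma hellingerSq_eq (hP : ∀ s, 0 ≤ P s) (hQ : ∀ s, 0 ≤ Q s)
    (hP1 : ∑ s, P s = 1) (hQ1 : ∑ s, Q s = 1) :
    hellingerSq P Q = 2 - 2 * bhattacharyya P Q := by
  have h : ∀ s, (√(P s) - √(Q s)) ^ 2 = P s + Q s - 2 * (√(P s) * √(Q s)) := fun s => by
    linear_combination Real.sq_sqrt (hP s) + Real.sq_sqrt (hQ s)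
  simp only [hellingerSq, bhattacharyya, h, Finset.sum_sub_distrib, Finset.sum_add_distrib,
    hP1, hQ1, ← Finset.mul_sum]
  norm_num

lemma sum_sqrt_add_sqrt_sq_eq (hP : ∀ s, 0 ≤ P s) (hQ : ∀ s, 0 ≤ Q s)
    (hP1 : ∑ s, P s = 1) (hQ1 : ∑ s, Q s = 1) :
    ∑ s, (√(P s) + √(Q s)) ^ 2 = 2 + 2 * bhattacharyya P Q := by
  have h : ∀ s, (√(P s) + √(Q s)) ^ 2 = P s + Q s + 2 * (√(P s) * √(Q s)) := fun s => by
    linear_combination Real.sq_sqrt (hP s) + Real.sq_sqrt (hQ s)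
  simp only [bhattacharyya, h, Finset.sum_add_distrib, hP1, hQ1, ← Finset.mul_sum]
  norm_num

lemma one_sub_bhattacharyya_le_tvDist (hP : ∀ s, 0 ≤ P s) (hQ : ∀ s, 0 ≤ Q s)
    (hP1 : ∑ s, P s = 1) (hQ1 : ∑ s, Q s = 1) :
    1 - bhattacharyya P Q ≤ tvDist P Q := by
  have h : hellingerSq P Q ≤ ∑ s, |P s - Q s| := by
    refine Finset.sum_le_sum fun s _ => ?_
    rw [← sqrt_sub_mul_sqrt_add (hP s) (hQ s), abs_mul, ← sq_abs, sq]
    refine mul_le_mul_of_nonneg_left ?_ (abs_nonneg _)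
    have ha := Real.sqrt_nonneg (P s)
    have hb := Real.sqrt_nonneg (Q s)
    rw [abs_of_nonneg (add_nonneg ha hb), abs_le]
    constructor <;> linarith
  rw [hellingerSq_eq hP hQ hP1 hQ1] at h
  rw [tvDist]
  linarith

lemma tvDist_sq_add_bhattacharyya_sq_le_one (hP : ∀ s, 0 ≤ P s) (hQ : ∀ s, 0 ≤ Q s)
    (hP1 : ∑ s, P s = 1) (hQ1 : ∑ s, Q s = 1) :
    tvDist P Q ^ 2 + bhattacharyya P Q ^ 2 ≤ 1 := by
  have h := Finset.sum_mul_sq_le_sq_mul_sq Finset.univ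
    (fun s => |√(P s) - √(Q s)|) (fun s => √(P s) + √(Q s))
  have e : ∀ s, |√(P s) - √(Q s)| * (√(P s) + √(Q s)) = |P s - Q s| := fun s => by
    rw [← sqrt_sub_mul_sqrt_add (hP s) (hQ s), abs_mul,
      abs_of_nonneg (by positivity : 0 ≤ √(P s) + √(Q s))]
  simp only [e, sq_abs] at h
  rw [sum_sqrt_add_sqrt_sq_eq hP hQ hP1 hQ1] at h
  change _ ≤ hellingerSq P Q * _ at h
  rw [hellingerSq_eq hP hQ hP1 hQ1] at h
  rw [tvDist]
  linarith

end Pmf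

lemma pushChannel_nonneg {X Y : Type} [Fintype X] [Fintype Y] {W : X → Y → ℝ}
    (hW : IsChannel W) {μ : X → ℝ} (hμ : ∀ x, 0 ≤ μ x) (y : Y) : 0 ≤ pushChannel W μ y :=
  Finset.sum_nonneg fun x _ => mul_nonneg (hμ x) ((hW x).1 y)

lemma sum_pushChannel {X Y : Type} [Fintype X] [Fintype Y] {W : X → Y → ℝ}
    (hW : IsChannel W) (μ : X → ℝ) : ∑ y, pushChannel W μ y = ∑ x, μ x := by
  simp only [pushChannel]
  rw [Finset.sum_comm]
  simp [← Finset.mul_sum, (hW _).2]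

lemma bern_nonneg {p : ℝ} (hp : p ∈ Set.Icc (0 : ℝ) 1) (b : Bool) : 0 ≤ bern p b := by
  cases b <;> simp [bern, hp.1, hp.2]

lemma sum_bern (p : ℝ) : ∑ b, bern p b = 1 := by
  simp [bern]

section Product

variable {n : ℕ} {Y : Fin n → Type} {P Q : (i : Fin n) → Y i → ℝ}

lemma prodDist_nonneg (hP : ∀ i y, 0 ≤ P i y) (y : (i : Fin n) → Y i) : 0 ≤ prodDist P y :=
  Finset.prod_nonneg fun i _ => hP i (y i)

variable [∀ i, Fintype (Y i)]

lemma sum_prodDist (P : (i : Fin n) → Y i → ℝ) : ∑ y, prodDist P y = ∏ i, ∑ y, P i y := by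
  rw [Finset.prod_univ_sum, Fintype.piFinset_univ]
  rfl

lemma bhattacharyya_prodDist (hP : ∀ i y, 0 ≤ P i y) (hQ : ∀ i y, 0 ≤ Q i y) :
    bhattacharyya (prodDist P) (prodDist Q) = ∏ i, bhattacharyya (P i) (Q i) := by
  simp only [bhattacharyya, ← sum_prodDist fun i y => √(P i y) * √(Q i y)]
  refine Finset.sum_congr rfl fun y _ => ?_
  simp only [prodDist, Finset.prod_mul_distrib]
  rw [Real.sqrt_prod _ fun i _ => hP i (y i), Real.sqrt_prod _ fun i _ => hQ i (y i)]

end Product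

lemma one_sub_sum_le_prod_one_sub {ι : Type*} (s : Finset ι) (x : ι → ℝ)
    (h0 : ∀ i ∈ s, 0 ≤ x i) (h1 : ∀ i ∈ s, x i ≤ 1) :
    1 - ∑ i ∈ s, x i ≤ ∏ i ∈ s, (1 - x i) := by
  classical
  induction s using Finset.induction_on with
  | empty => simp
  | insert a s ha ih =>
    simp only [Finset.forall_mem_insert] at h0 h1
    rw [Finset.sum_insert ha, Finset.prod_insert ha]
    have := mul_le_mul_of_nonneg_left (ih h0.2 h1.2) (sub_nonneg.2 h1.1)
    nlinarith [mul_nonneg h0.1 (Finset.sum_nonneg h0.2)]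

lemma prod_one_sub_le_exp_neg_sum {ι : Type*} (s : Finset ι) (x : ι → ℝ)
    (h1 : ∀ i ∈ s, x i ≤ 1) :
    ∏ i ∈ s, (1 - x i) ≤ Real.exp (-∑ i ∈ s, x i) := by
  rw [← Finset.sum_neg_distrib, Real.exp_sum]
  exact Finset.prod_le_prod (fun i hi => sub_nonneg.2 (h1 i hi))
    fun i _ => Real.one_sub_le_exp_neg (x i)

theorem tvDist_prodDist_dichotomy {n : ℕ} {Y : Fin n → Type} [∀ i, Fintype (Y i)]
    {P Q R : (i : Fin n) → Y i → ℝ}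
    (hP : ∀ i y, 0 ≤ P i y) (hQ : ∀ i y, 0 ≤ Q i y) (hR : ∀ i y, 0 ≤ R i y)
    (hP1 : ∀ i, ∑ y, P i y = 1) (hQ1 : ∀ i, ∑ y, Q i y = 1) (hR1 : ∀ i, ∑ y, R i y = 1)
    {lam : ℝ} (hlam : 0 ≤ lam)
    (hdom : ∀ i, lam * hellingerSq (Q i) (R i) ≤ hellingerSq (P i) (Q i)) :
    tvDist (prodDist Q) (prodDist R) ≤ 1 / 2 ∨
      1 - Real.exp (-(1 - √3 / 2) * lam) ≤ tvDist (prodDist P) (prodDist Q) := by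
  have sum_one : ∀ {F : (i : Fin n) → Y i → ℝ}, (∀ i, ∑ y, F i y = 1) →
      ∑ y, prodDist F y = 1 := fun hF => by simp [sum_prodDist, hF]
  have bhat_eq : ∀ {F G : (i : Fin n) → Y i → ℝ}, (∀ i y, 0 ≤ F i y) → (∀ i y, 0 ≤ G i y) →
      (∀ i, ∑ y, F i y = 1) → (∀ i, ∑ y, G i y = 1) →
      (∀ i ∈ Finset.univ, hellingerSq (F i) (G i) / 2 ≤ 1) ∧
      bhattacharyya (prodDist F) (prodDist G) = ∏ i, (1 - hellingerSq (F i) (G i) / 2) := by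
    intro F G hF hG hF1 hG1
    have e : ∀ i, hellingerSq (F i) (G i) = 2 - 2 * bhattacharyya (F i) (G i) := fun i =>
      hellingerSq_eq (hF i) (hG i) (hF1 i) (hG1 i)
    refine ⟨fun i _ => ?_, ?_⟩
    · linarith [e i, bhattacharyya_nonneg (F i) (G i)]
    · rw [bhattacharyya_prodDist hF hG]
      exact Finset.prod_congr rfl fun i _ => by linarith [e i]
  refine or_iff_not_imp_left.2 fun htv => ?_
  rw [not_le] at htv
  obtain ⟨hQR_le, hQR⟩ := bhat_eq hQ hR hQ1 hR1
  obtain ⟨hPQ_le, hPQ⟩ := bhat_eq hP hQ hP1 hQ1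
  have hsmall : bhattacharyya (prodDist Q) (prodDist R) ≤ √3 / 2 := by
    have h := tvDist_sq_add_bhattacharyya_sq_le_one (prodDist_nonneg hQ) (prodDist_nonneg hR)
      (sum_one hQ1) (sum_one hR1)
    refine (abs_le_of_sq_le_sq' ?_ (by positivity)).2
    rw [div_pow, Real.sq_sqrt (by norm_num)]
    nlinarith
  have hsum : 1 - √3 / 2 ≤ ∑ i, hellingerSq (Q i) (R i) / 2 := by
    have h := one_sub_sum_le_prod_one_sub Finset.univ (fun i => hellingerSq (Q i) (R i) / 2)
      (fun i _ => div_nonneg (hellingerSq_nonneg _ _) zero_le_two) hQR_le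
    linarith
  have hdom_sum : (1 - √3 / 2) * lam ≤ ∑ i, hellingerSq (P i) (Q i) / 2 := by
    refine (mul_le_mul_of_nonneg_right hsum hlam).trans ?_
    rw [Finset.sum_mul]
    exact Finset.sum_le_sum fun i _ => by linarith [hdom i]
  have hexp := prod_one_sub_le_exp_neg_sum Finset.univ _ hPQ_le
  have hmono : Real.exp (-∑ i, hellingerSq (P i) (Q i) / 2) ≤
      Real.exp (-(1 - √3 / 2) * lam) := Real.exp_le_exp.2 (by linarith)
  have htv' := one_sub_bhattacharyya_le_tvDist (prodDist_nonneg hP) (prodDist_nonneg hQ)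
    (sum_one hP1) (sum_one hQ1)
  linarith

/-- if `H²(P⁰ᵢ, P¹ᵢ) ≥ λ·H²(P¹ᵢ, P²ᵢ)` for every `i`, where `Pʲᵢ = Wᵢ∘Ber(pⱼ)`,
then either `d_TV(P¹_{Yⁿ}, P²_{Yⁿ}) ≤ 1/2` or
`d_TV(P⁰_{Yⁿ}, P¹_{Yⁿ}) ≥ 1 − e^{−(1−√3/2)·λ}`. -/
theorem stmt4 (n : ℕ) (p0 p1 p2 : ℝ)
    (hp0 : p0 ∈ Set.Icc (0:ℝ) 1) (hp1 : p1 ∈ Set.Icc (0:ℝ) 1) (hp2 : p2 ∈ Set.Icc (0:ℝ) 1)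
    {Y : Fin n → Type} [∀ i, Fintype (Y i)]
    (W : (i : Fin n) → Bool → Y i → ℝ) (hW : ∀ i, IsChannel (W i))
    (lam : ℝ) (hlam : 0 < lam)
    (hdom : ∀ i : Fin n,
      lam * hellingerSq (pushChannel (W i) (bern p1)) (pushChannel (W i) (bern p2)) ≤
        hellingerSq (pushChannel (W i) (bern p0)) (pushChannel (W i) (bern p1))) :
    tvDist (prodDist (fun i => pushChannel (W i) (bern p1)))
        (prodDist (fun i => pushChannel (W i) (bern p2))) ≤ 1 / 2 ∨
      1 - Real.exp (-(1 - Real.sqrt 3 / 2) * lam) ≤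
        tvDist (prodDist (fun i => pushChannel (W i) (bern p0)))
          (prodDist (fun i => pushChannel (W i) (bern p1))) := by
  have nonneg : ∀ {p : ℝ}, p ∈ Set.Icc (0 : ℝ) 1 → ∀ i y, 0 ≤ pushChannel (W i) (bern p) y :=
    fun hp i => pushChannel_nonneg (hW i) (bern_nonneg hp)
  have sum_one : ∀ p i, ∑ y, pushChannel (W i) (bern p) y = 1 :=
    fun p i => (sum_pushChannel (hW i) _).trans (sum_bern p)
  exact tvDist_prodDist_dichotomy (nonneg hp0) (nonneg hp1) (nonneg hp2)
    (sum_one p0) (sum_one p1) (sum_one p2) hlam.le hdom
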